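/- Let n ≥ 5 and 1 ≤ p < (n−1)/(n−2), and set α₁ := c_nᵖ/(((n−2)p−2)(n−(n−2)p)). Let x₀ ∈ ℝⁿ, R > 0, let H be harmonic on B(x₀,R) and let H̃ ∈ C¹(B(x₀,R)). For x ∈ B(x₀,R)∖{x₀} define G(x) := c_n|x−x₀|^{2−n} − H(x) and G̃(x) := α₁|x−x₀|^{−((n−2)p−2)} − H̃(x). Assume G > 0 on B(x₀,R)∖{x₀}, that G̃ is twice continuously differentiable there, and that −ΔG̃ = Gᵖ on B(x₀,R)∖{x₀}. Then for every r ∈ (0,R) and every j ∈ {1,…,n}: ∫_{∂B(x₀,r)} [ (∂G̃/∂ν)(∂G/∂x_j) + (∂G/∂ν)(∂G̃/∂x_j) ] dS − ∫_{∂B(x₀,r)} (∇G·∇G̃) ν_j dS + (1/(p+1)) ∫_{∂B(x₀,r)} G^{p+1} ν_j dS = (n−2) c_n ω_{n−1} (∂H̃/∂x_j)(x₀). In particular the left-hand side is independent of r ∈ (0,R). -/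

import Mathlib

open MeasureTheory Metric Filter Topology RealInnerProductSpace

noncomputable section

abbrev Euc (n : ℕ) := EuclideanSpace ℝ (Fin n)

noncomputable def surf (n : ℕ) : Measure (Euc n) := μH[(n : ℝ) - 1]

noncomputable def omegaSph (n : ℕ) : ℝ := (surf n (sphere (0 : Euc n) 1)).toReal

/-- `c_n = 1/((n-2) ω_{n-1})`. -/
noncomputable def cGreen (n : ℕ) : ℝ := 1 / (((n : ℝ) - 2) * omegaSph n)

/-- `α₁ = c_nᵖ/(((n-2)p-2)(n-(n-2)p))`. -/
noncomputable def alpha1 (n : ℕ) (p : ℝ) : ℝ :=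
  cGreen n ^ p / ((((n : ℝ) - 2) * p - 2) * ((n : ℝ) - ((n : ℝ) - 2) * p))

/-- Laplacian on `ℝⁿ`. -/
noncomputable def lap (n : ℕ) (u : Euc n → ℝ) (x : Euc n) : ℝ :=
  ∑ i : Fin n, fderiv ℝ (fun y => fderiv ℝ u y (EuclideanSpace.single i 1)) x
    (EuclideanSpace.single i 1)

theorem surf_unit_sphere_lt_top (n : ℕ) : surf n (sphere (0 : Euc n) 1) < ⊤ := by
  refine (isCompact_sphere (0 : Euc n) 1).measure_lt_top_of_nhdsWithin fun v hv => ?_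
  have hv1 : ‖v‖ = 1 := by simpa using hv
  have hv0 : v ≠ 0 := by
    rintro rfl
    simp at hv1
  have hvv : ⟪v, v⟫ = 1 := by rw [real_inner_self_eq_norm_sq, hv1, one_pow]
  let f : (ℝ ∙ v)ᗮ → Euc n := fun w => ‖v + w‖⁻¹ • (v + (w : Euc n))
  have hinner (w : (ℝ ∙ v)ᗮ) : ⟪v, v + (w : Euc n)⟫ = 1 := by
    rw [inner_add_right, hvv, Submodule.mem_orthogonal_singleton_iff_inner_right.1 w.2, add_zero]
  have hne (w : (ℝ ∙ v)ᗮ) : v + (w : Euc n) ≠ 0 := fun h => by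
    simpa [h] using hinner w
  have hf : ContDiff ℝ 1 f := by
    have h1 : ContDiff ℝ 1 fun w : (ℝ ∙ v)ᗮ => v + (w : Euc n) :=
      contDiff_const.add (ℝ ∙ v)ᗮ.subtypeL.contDiff
    exact ((h1.norm ℝ hne).inv fun w => norm_ne_zero_iff.2 (hne w)).smul h1
  obtain ⟨K, hK⟩ := (hf.contDiffOn (s := closedBall 0 3)).exists_lipschitzOnWith one_ne_zero
    (convex_closedBall 0 3) (isCompact_closedBall 0 3)
  have hrank : (Module.finrank ℝ (ℝ ∙ v)ᗮ : ℝ) = n - 1 := by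
    have h := Submodule.finrank_add_finrank_orthogonal (ℝ ∙ v)
    rw [finrank_span_singleton hv0, finrank_euclideanSpace_fin] at h
    rw [eq_sub_iff_add_eq']
    exact_mod_cast h
  refine ⟨f '' closedBall 0 3, ?_, ?_⟩
  · have hopen : {z : Euc n | 1 / 2 < ⟪v, z⟫} ∈ 𝓝 v :=
      (isOpen_lt continuous_const (by fun_prop)).mem_nhds (by
        rw [Set.mem_ofPred_eq, hvv]
        norm_num)
    filter_upwards [self_mem_nhdsWithin, mem_nhdsWithin_of_mem_nhds hopen] with z hz hz'
    have hz1 : ‖z‖ = 1 := by simpa using hz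
    have ht' : 1 / 2 < ⟪v, z⟫ := hz'
    have ht : 0 < ⟪v, z⟫ := by linarith
    refine ⟨⟨⟪v, z⟫⁻¹ • z - v, ?_⟩, ?_, ?_⟩
    · rw [Submodule.mem_orthogonal_singleton_iff_inner_right, inner_sub_right, hvv,
        real_inner_smul_right, inv_mul_cancel₀ ht.ne', sub_self]
    · rw [mem_closedBall_zero_iff, Submodule.coe_norm]
      refine (norm_sub_le _ _).trans ?_
      rw [norm_smul, hz1, hv1, norm_inv, Real.norm_of_nonneg ht.le, mul_one]
      have : ⟪v, z⟫⁻¹ ≤ 2 := by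
        rw [inv_le_comm₀ ht two_pos]
        linarith
      linarith
    · simp only [f, add_sub_cancel, norm_smul, hz1, norm_inv, Real.norm_of_nonneg ht.le, mul_one,
        inv_inv, smul_smul, mul_inv_cancel₀ ht.ne', one_smul]
  · have hn' : (0 : ℝ) ≤ n - 1 := by
      rw [← hrank]
      positivity
    refine (hK.hausdorffMeasure_image_le hn').trans_lt (ENNReal.mul_lt_top ?_ ?_)
    · exact ENNReal.rpow_lt_top_of_nonneg hn' ENNReal.coe_ne_top
    · rw [← hrank]
      exact (isCompact_closedBall 0 3).measure_lt_top

/-- The surface measure on the unit sphere. -/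
def unitSphereMeasure (n : ℕ) : Measure (Euc n) := (surf n).restrict (sphere 0 1)

instance isFiniteMeasure_unitSphereMeasure (n : ℕ) : IsFiniteMeasure (unitSphereMeasure n) :=
  ⟨by simpa [unitSphereMeasure] using surf_unit_sphere_lt_top n⟩

theorem ae_unitSphereMeasure_mem (n : ℕ) : ∀ᵐ x ∂unitSphereMeasure n, x ∈ sphere (0 : Euc n) 1 :=
  ae_restrict_mem isClosed_sphere.measurableSet

open scoped Pointwise in
theorem setIntegral_sphere_eq {n : ℕ} (hn : 1 ≤ n) (x₀ : Euc n) {r : ℝ} (hr : 0 < r)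
    (f : Euc n → ℝ) :
    ∫ x in sphere x₀ r, f x ∂surf n = r ^ (n - 1) * ∫ w, f (x₀ + r • w) ∂unitSphereMeasure n := by
  have hn' : (0 : ℝ) ≤ n - 1 := by
    rw [sub_nonneg]
    exact_mod_cast hn
  let e : Euc n ≃ₜ Euc n := (Homeomorph.smulOfNeZero r hr.ne').trans (Homeomorph.addLeft x₀)
  have he (w : Euc n) : e w = x₀ + r • w := rfl
  have hmap : Measure.map e (surf n) = ENNReal.ofReal (r⁻¹ ^ (n - 1)) • surf n := by
    ext s hs
    have hpre : e ⁻¹' s = r⁻¹ • ((fun x => x₀ + x) ⁻¹' s) := by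
      ext w
      rw [Set.mem_smul_set_iff_inv_smul_mem₀ (inv_ne_zero hr.ne'), inv_inv]
      rfl
    rw [Measure.map_apply e.continuous.measurable hs, Measure.smul_apply, hpre, surf,
      Measure.hausdorffMeasure_smul₀ hn' (inv_ne_zero hr.ne')]
    have htrans : μH[(n : ℝ) - 1] ((fun x => x₀ + x) ⁻¹' s) = μH[(n : ℝ) - 1] s :=
      (IsometryEquiv.addLeft x₀).hausdorffMeasure_preimage ((n : ℝ) - 1) s
    have hcoef : ‖r⁻¹‖₊ ^ ((n : ℝ) - 1) = Real.toNNReal (r⁻¹ ^ (n - 1)) := by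
      rw [← Nat.cast_one, ← Nat.cast_sub hn, NNReal.rpow_natCast, Real.toNNReal_pow (by positivity),
        ← Real.toNNReal_eq_nnnorm_of_nonneg (by positivity)]
    rw [htrans, hcoef]
    rfl
  have hpre : e ⁻¹' sphere x₀ r = sphere 0 1 := by
    ext w
    simp [he, norm_smul, abs_of_pos hr, hr.ne']
  have h := e.measurableEmbedding.setIntegral_map (μ := surf n) f (sphere x₀ r)
  rw [hmap, hpre, Measure.restrict_smul, integral_smul_measure,
    ENNReal.toReal_ofReal (by positivity)] at h
  simp only [he] at h
  rw [unitSphereMeasure, ← h, smul_eq_mul, ← mul_assoc, ← mul_pow, mul_inv_cancel₀ hr.ne', one_pow,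
    one_mul]

theorem measurePreserving_unitSphereMeasure {n : ℕ} (L : Euc n ≃ₗᵢ[ℝ] Euc n) :
    MeasurePreserving L (unitSphereMeasure n) (unitSphereMeasure n) := by
  have h := (L.toIsometryEquiv.measurePreserving_hausdorffMeasure ((n : ℝ) - 1)).restrict_preimage
    (isClosed_sphere (x := (0 : Euc n)) (ε := 1)).measurableSet
  have hpre : L.toIsometryEquiv ⁻¹' sphere (0 : Euc n) 1 = sphere 0 1 := by
    ext w
    simp
  rw [hpre] at h
  exact h

theorem integral_comp_unitSphereMeasure {n : ℕ} (L : Euc n ≃ₗᵢ[ℝ] Euc n) (f : Euc n → ℝ) :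
    ∫ w, f (L w) ∂unitSphereMeasure n = ∫ w, f w ∂unitSphereMeasure n :=
  (measurePreserving_unitSphereMeasure L).integral_comp
    L.toHomeomorph.measurableEmbedding f

theorem integral_coord_unitSphereMeasure {n : ℕ} (j : Fin n) :
    ∫ w, w j ∂unitSphereMeasure n = 0 := by
  have h := integral_comp_unitSphereMeasure (LinearIsometryEquiv.neg ℝ) fun w : Euc n => w j
  simp only [LinearIsometryEquiv.coe_neg, PiLp.neg_apply, integral_neg] at h
  linarith

theorem integrable_unitSphereMeasure {n : ℕ} {f : Euc n → ℝ}
    (hf : ContinuousOn f (sphere (0 : Euc n) 1)) : Integrable f (unitSphereMeasure n) := by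
  obtain ⟨C, hC⟩ := (isCompact_sphere (0 : Euc n) 1).exists_bound_of_continuousOn hf
  refine Integrable.of_bound (hf.aestronglyMeasurable isClosed_sphere.measurableSet) C ?_
  filter_upwards [ae_unitSphereMeasure_mem n] with w hw using hC w hw

theorem hasDerivAt_integral_unitSphereMeasure {n : ℕ} {f f' : ℝ → Euc n → ℝ} {t₀ ε : ℝ} (hε : 0 < ε)
    (hd : ∀ t ∈ closedBall t₀ ε, ∀ w ∈ sphere (0 : Euc n) 1, HasDerivAt (f · w) (f' t w) t)
    (hf : ∀ t ∈ closedBall t₀ ε, ContinuousOn (f t) (sphere 0 1))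
    (hf' : ContinuousOn (fun q : ℝ × Euc n => f' q.1 q.2) (closedBall t₀ ε ×ˢ sphere 0 1)) :
    HasDerivAt (fun t => ∫ w, f t w ∂unitSphereMeasure n) (∫ w, f' t₀ w ∂unitSphereMeasure n) t₀ := by
  have ht₀ : t₀ ∈ closedBall t₀ ε := mem_closedBall_self hε.le
  obtain ⟨C, hC⟩ := ((isCompact_closedBall t₀ ε).prod
    (isCompact_sphere (0 : Euc n) 1)).exists_bound_of_continuousOn hf'
  refine (hasDerivAt_integral_of_dominated_loc_of_deriv_le (bound := fun _ => C)
    (closedBall_mem_nhds t₀ hε) ?_ (integrable_unitSphereMeasure (hf t₀ ht₀)) ?_ ?_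
    (integrable_const C) ?_).2
  · filter_upwards [closedBall_mem_nhds t₀ hε] with t ht
    exact (integrable_unitSphereMeasure (hf t ht)).aestronglyMeasurable
  · refine ContinuousOn.aestronglyMeasurable ?_ isClosed_sphere.measurableSet
    exact hf'.comp (f := fun w : Euc n => (t₀, w)) (by fun_prop) fun w hw => ⟨ht₀, hw⟩
  · filter_upwards [ae_unitSphereMeasure_mem n] with w hw t ht using hC (t, w) ⟨ht, hw⟩
  · filter_upwards [ae_unitSphereMeasure_mem n] with w hw t ht using hd t ht w hw

/-- The rotation by the angle `t` in the oriented coordinate plane `(i, k)`. -/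
def planeRotation {n : ℕ} (i k : Fin n) (t : ℝ) (x : Euc n) : Euc n :=
  x + ((Real.cos t - 1) * x i - Real.sin t * x k) • EuclideanSpace.single i (1 : ℝ)
    + ((Real.cos t - 1) * x k + Real.sin t * x i) • EuclideanSpace.single k (1 : ℝ)

theorem norm_planeRotation {n : ℕ} {i k : Fin n} (hik : i ≠ k) (t : ℝ) (x : Euc n) :
    ‖planeRotation i k t x‖ = ‖x‖ := by
  rw [← sq_eq_sq₀ (norm_nonneg _) (norm_nonneg _), ← real_inner_self_eq_norm_sq,
    ← real_inner_self_eq_norm_sq, planeRotation]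
  simp only [inner_add_left, inner_add_right, real_inner_smul_left, real_inner_smul_right,
    EuclideanSpace.inner_single_left, EuclideanSpace.inner_single_right, PiLp.smul_apply,
    smul_eq_mul, PiLp.single_apply, hik, hik.symm, if_true, if_false, map_one,
    one_mul, mul_zero, mul_one, conj_trivial]
  linear_combination (x i ^ 2 + x k ^ 2) * Real.sin_sq_add_cos_sq t

theorem exists_linearIsometryEquiv_planeRotation {n : ℕ} {i k : Fin n} (hik : i ≠ k) (t : ℝ) :
    ∃ L : Euc n ≃ₗᵢ[ℝ] Euc n, ∀ x, L x = planeRotation i k t x := by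
  let f : Euc n →ₗ[ℝ] Euc n :=
    { toFun := planeRotation i k t
      map_add' := fun x y => by
        simp only [planeRotation, PiLp.add_apply]
        module
      map_smul' := fun c x => by
        simp only [planeRotation, PiLp.smul_apply, smul_eq_mul, RingHom.id_apply]
        module }
  exact ⟨LinearIsometry.toLinearIsometryEquiv ⟨f, norm_planeRotation hik t⟩ rfl, fun x => rfl⟩

theorem hasDerivAt_planeRotation {n : ℕ} (i k : Fin n) (t : ℝ) (x : Euc n) :
    HasDerivAt (fun t => planeRotation i k t x)
      ((-Real.sin t * x i - Real.cos t * x k) • EuclideanSpace.single i (1 : ℝ)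
        + (-Real.sin t * x k + Real.cos t * x i) • EuclideanSpace.single k (1 : ℝ)) t := by
  have h1 := (((Real.hasDerivAt_cos t).sub_const 1).mul_const (x i)).sub
    ((Real.hasDerivAt_sin t).mul_const (x k))
  have h2 := (((Real.hasDerivAt_cos t).sub_const 1).mul_const (x k)).add
    ((Real.hasDerivAt_sin t).mul_const (x i))
  exact ((h1.smul_const (EuclideanSpace.single i (1 : ℝ))).const_add x).add
    (h2.smul_const (EuclideanSpace.single k (1 : ℝ)))

theorem ContDiffAt.continuousAt_fderiv_of_one {E : Type*} [NormedAddCommGroup E] [NormedSpace ℝ E]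
    {f : E → ℝ} {x : E} (hf : ContDiffAt ℝ 1 f x) : ContinuousAt (fderiv ℝ f) x :=
  (hf.fderiv_right (m := 0) (by simp)).continuousAt

theorem integral_rotationField_unitSphereMeasure {n : ℕ} {f : Euc n → ℝ}
    (hf : ∀ x ∈ sphere (0 : Euc n) 1, ContDiffAt ℝ 1 f x) (i k : Fin n) :
    ∫ w, (w i * fderiv ℝ f w (EuclideanSpace.single k 1)
      - w k * fderiv ℝ f w (EuclideanSpace.single i 1)) ∂unitSphereMeasure n = 0 := by
  rcases eq_or_ne i k with rfl | hik
  · simp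
  have hmem (t : ℝ) {w : Euc n} (hw : w ∈ sphere (0 : Euc n) 1) :
      planeRotation i k t w ∈ sphere (0 : Euc n) 1 := by
    rw [mem_sphere_zero_iff_norm, norm_planeRotation hik]
    simpa using hw
  have hcont : Continuous fun q : ℝ × Euc n => planeRotation i k q.1 q.2 := by
    unfold planeRotation
    fun_prop
  have h := hasDerivAt_integral_unitSphereMeasure (t₀ := 0) one_pos
    (f := fun t w => f (planeRotation i k t w))
    (fun t _ w hw => ((hf _ (hmem t hw)).differentiableAt one_ne_zero).hasFDerivAt.comp_hasDerivAt t
      (hasDerivAt_planeRotation i k t w))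
    (fun t _ w hw => ((hf _ (hmem t hw)).continuousAt.comp
      (f := fun w => planeRotation i k t w) (by fun_prop)).continuousWithinAt)
    (fun q hq => by
      refine ContinuousAt.continuousWithinAt (ContinuousAt.clm_apply ?_ (by fun_prop))
      exact (hf _ (hmem q.1 hq.2)).continuousAt_fderiv_of_one.comp
        (f := fun q : ℝ × Euc n => planeRotation i k q.1 q.2) hcont.continuousAt)
  have hconst : (fun t => ∫ w, f (planeRotation i k t w) ∂unitSphereMeasure n)
      = fun _ => ∫ w, f w ∂unitSphereMeasure n := by
    funext t
    obtain ⟨L, hL⟩ := exists_linearIsometryEquiv_planeRotation hik t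
    simp only [← hL, integral_comp_unitSphereMeasure]
  rw [hconst] at h
  rw [← h.unique (hasDerivAt_const _ _)]
  congr 1
  funext w
  simp [planeRotation]
  ring

/-- The flux of the vector field `V` through the sphere of radius `s` about `x₀`. -/
def sphereFlux {n : ℕ} (V : Fin n → Euc n → ℝ) (x₀ : Euc n) (s : ℝ) : ℝ :=
  s ^ (n - 1) * ∫ w, ∑ i, V i (x₀ + s • w) * w i ∂unitSphereMeasure n

theorem mem_punctured_ball {n : ℕ} {x₀ w : Euc n} {R s : ℝ} (hs : s ∈ Set.Ioo 0 R)
    (hw : w ∈ sphere (0 : Euc n) 1) : x₀ + s • w ∈ ball x₀ R \ {x₀} := by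
  have hw' : ‖w‖ = 1 := by simpa using hw
  refine ⟨?_, ?_⟩
  · simpa [norm_smul, hw', abs_of_pos hs.1] using hs.2
  · have : w ≠ 0 := by
      rintro rfl
      simp at hw'
    simp [hs.1.ne', this]

theorem clm_apply_eq_sum_single {n : ℕ} (L : Euc n →L[ℝ] ℝ) (w : Euc n) :
    L w = ∑ k, w k * L (EuclideanSpace.single k 1) := by
  have h : w = ∑ k, w k • EuclideanSpace.single k (1 : ℝ) := by
    simpa using ((EuclideanSpace.basisFun (Fin n) ℝ).sum_repr w).symm
  calc L w = L (∑ k, w k • EuclideanSpace.single k (1 : ℝ)) := by rw [← h]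
    _ = _ := by simp only [map_sum, map_smul, smul_eq_mul]

theorem sum_sq_eq_one_of_mem_sphere {n : ℕ} {w : Euc n} (hw : w ∈ sphere (0 : Euc n) 1) :
    ∑ k, w k * w k = 1 := by
  have hw' : ‖w‖ = 1 := by simpa using hw
  have h := EuclideanSpace.real_norm_sq_eq w
  rw [hw', one_pow] at h
  rw [h]
  exact Finset.sum_congr rfl fun k _ => (sq (w k)).symm

theorem radial_deriv_eq_of_div_eq_zero {n : ℕ} {x₀ : Euc n} {R s : ℝ} {V : Fin n → Euc n → ℝ}
    (hV : ∀ i, ∀ x ∈ ball x₀ R \ {x₀}, ContDiffAt ℝ 1 (V i) x)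
    (hdiv : ∀ x ∈ ball x₀ R \ {x₀}, ∑ i, fderiv ℝ (V i) x (EuclideanSpace.single i 1) = 0)
    (hs : s ∈ Set.Ioo 0 R) :
    s * ∫ w, ∑ i, fderiv ℝ (V i) (x₀ + s • w) w * w i ∂unitSphereMeasure n
      = (1 - n) * ∫ w, ∑ i, V i (x₀ + s • w) * w i ∂unitSphereMeasure n := by
  have hV' (i : Fin n) {w : Euc n} (hw : w ∈ sphere (0 : Euc n) 1) :
      ContDiffAt ℝ 1 (fun w => V i (x₀ + s • w)) w :=
    (hV i _ (mem_punctured_ball hs hw)).comp w (f := fun w => x₀ + s • w) (by fun_prop)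
  have hg (i k : Fin n) {w : Euc n} (hw : w ∈ sphere (0 : Euc n) 1) :
      ContDiffAt ℝ 1 (fun w => V i (x₀ + s • w) * w k) w :=
    (hV' i hw).mul (by fun_prop)
  have hgd (i k : Fin n) {w : Euc n} (hw : w ∈ sphere (0 : Euc n) 1) (v : Euc n) :
      fderiv ℝ (fun w => V i (x₀ + s • w) * w k) w v
        = s * fderiv ℝ (V i) (x₀ + s • w) v * w k + V i (x₀ + s • w) * v k := by
    have h1 : HasFDerivAt (fun w : Euc n => x₀ + s • w) (s • ContinuousLinearMap.id ℝ (Euc n)) w :=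
      ((hasFDerivAt_id w).const_smul s).const_add x₀
    have h2 := ((hV i _ (mem_punctured_ball hs hw)).differentiableAt
      one_ne_zero).hasFDerivAt.comp w h1
    have h3 : HasFDerivAt (fun w : Euc n => w k) (EuclideanSpace.proj k : Euc n →L[ℝ] ℝ) w :=
      (EuclideanSpace.proj k : Euc n →L[ℝ] ℝ).hasFDerivAt
    rw [HasFDerivAt.fderiv (f := fun w => V i (x₀ + s • w) * w k) (h2.mul h3)]
    simp
    ring
  have hc (i k : Fin n) (v : Euc n) : ContinuousOn
      (fun w => fderiv ℝ (fun w => V i (x₀ + s • w) * w k) w v) (sphere (0 : Euc n) 1) :=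
    fun w hw => ((hg i k hw).continuousAt_fderiv_of_one.clm_apply
      continuousAt_const).continuousWithinAt
  have hint (i k : Fin n) : Integrable (fun w =>
      w k * fderiv ℝ (fun w => V i (x₀ + s • w) * w k) w (EuclideanSpace.single i 1)
      - w i * fderiv ℝ (fun w => V i (x₀ + s • w) * w k) w (EuclideanSpace.single k 1))
      (unitSphereMeasure n) := by
    have := hc i k (EuclideanSpace.single i 1)
    have := hc i k (EuclideanSpace.single k 1)
    exact integrable_unitSphereMeasure (by fun_prop)
  have hsum : ∫ w, ∑ i, ∑ k,
      (w k * fderiv ℝ (fun w => V i (x₀ + s • w) * w k) w (EuclideanSpace.single i 1)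
      - w i * fderiv ℝ (fun w => V i (x₀ + s • w) * w k) w (EuclideanSpace.single k 1))
      ∂unitSphereMeasure n = 0 := by
    rw [integral_finsetSum _ fun i _ => integrable_finsetSum _ fun k _ => hint i k]
    refine Finset.sum_eq_zero fun i _ => ?_
    rw [integral_finsetSum _ fun k _ => hint i k]
    exact Finset.sum_eq_zero fun k _ =>
      integral_rotationField_unitSphereMeasure (fun x hx => hg i k hx) k i
  have hpt : ∀ᵐ w ∂unitSphereMeasure n, ∑ i, ∑ k,
      (w k * fderiv ℝ (fun w => V i (x₀ + s • w) * w k) w (EuclideanSpace.single i 1)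
      - w i * fderiv ℝ (fun w => V i (x₀ + s • w) * w k) w (EuclideanSpace.single k 1))
      = (1 - n) * ∑ i, V i (x₀ + s • w) * w i
        - s * ∑ i, fderiv ℝ (V i) (x₀ + s • w) w * w i := by
    filter_upwards [ae_unitSphereMeasure_mem n] with w hw
    have hw2 := sum_sq_eq_one_of_mem_sphere hw
    have hrow (i : Fin n) : ∑ k,
        (w k * fderiv ℝ (fun w => V i (x₀ + s • w) * w k) w (EuclideanSpace.single i 1)
        - w i * fderiv ℝ (fun w => V i (x₀ + s • w) * w k) w (EuclideanSpace.single k 1))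
        = s * fderiv ℝ (V i) (x₀ + s • w) (EuclideanSpace.single i 1)
          + (1 - n) * (V i (x₀ + s • w) * w i)
          - s * (fderiv ℝ (V i) (x₀ + s • w) w * w i) := by
      have hlin := clm_apply_eq_sum_single (fderiv ℝ (V i) (x₀ + s • w)) w
      have hexp (k : Fin n) :
          w k * fderiv ℝ (fun w => V i (x₀ + s • w) * w k) w (EuclideanSpace.single i 1)
          - w i * fderiv ℝ (fun w => V i (x₀ + s • w) * w k) w (EuclideanSpace.single k 1)
          = s * fderiv ℝ (V i) (x₀ + s • w) (EuclideanSpace.single i 1) * (w k * w k)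
            + (if k = i then V i (x₀ + s • w) * w k else 0)
            - s * w i * (w k * fderiv ℝ (V i) (x₀ + s • w) (EuclideanSpace.single k 1))
            - V i (x₀ + s • w) * w i := by
        rw [hgd i k hw, hgd i k hw]
        simp only [PiLp.single_apply, if_true]
        split_ifs <;> ring
      simp only [hexp, Finset.sum_sub_distrib, Finset.sum_add_distrib, ← Finset.mul_sum, hw2,
        ← hlin, Finset.sum_ite_eq', Finset.mem_univ, if_true, Finset.sum_const, Finset.card_univ,
        Fintype.card_fin, nsmul_eq_mul]
      ring
    simp only [hrow, Finset.sum_sub_distrib, Finset.sum_add_distrib, ← Finset.mul_sum,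
      hdiv _ (mem_punctured_ball hs hw)]
    ring
  have hVc (i : Fin n) : ContinuousOn (fun w => V i (x₀ + s • w)) (sphere (0 : Euc n) 1) :=
    fun w hw => (hV' i hw).continuousAt.continuousWithinAt
  have hVd (i : Fin n) :
      ContinuousOn (fun w => fderiv ℝ (V i) (x₀ + s • w) w) (sphere (0 : Euc n) 1) := fun w hw =>
    (((hV i _ (mem_punctured_ball hs hw)).continuousAt_fderiv_of_one.comp
      (f := fun w => x₀ + s • w) (by fun_prop)).clm_apply continuousAt_id).continuousWithinAt
  rw [integral_congr_ae hpt, integral_sub, integral_const_mul, integral_const_mul] at hsum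
  · linarith
  · exact (integrable_unitSphereMeasure (continuousOn_finsetSum _ fun i _ =>
      (hVc i).mul (by fun_prop))).const_mul _
  · exact (integrable_unitSphereMeasure (continuousOn_finsetSum _ fun i _ =>
      (hVd i).mul (by fun_prop))).const_mul _

theorem hasDerivAt_sphereFlux {n : ℕ} (hn : 2 ≤ n) {x₀ : Euc n} {R s : ℝ} {V : Fin n → Euc n → ℝ}
    (hV : ∀ i, ∀ x ∈ ball x₀ R \ {x₀}, ContDiffAt ℝ 1 (V i) x)
    (hdiv : ∀ x ∈ ball x₀ R \ {x₀}, ∑ i, fderiv ℝ (V i) x (EuclideanSpace.single i 1) = 0)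
    (hs : s ∈ Set.Ioo 0 R) : HasDerivAt (sphereFlux V x₀) 0 s := by
  obtain ⟨ε, hε, hsub⟩ := nhds_basis_closedBall.mem_iff.1 (isOpen_Ioo.mem_nhds hs)
  have hI := hasDerivAt_integral_unitSphereMeasure hε
    (f := fun t w => ∑ i, V i (x₀ + t • w) * w i)
    (f' := fun t w => ∑ i, fderiv ℝ (V i) (x₀ + t • w) w * w i)
    (fun t ht w hw => by
      refine HasDerivAt.fun_sum fun i _ => HasDerivAt.mul_const ?_ (w i)
      have h1 : HasDerivAt (fun t : ℝ => x₀ + t • w) w t := by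
        simpa using ((hasDerivAt_id t).smul_const w).const_add x₀
      exact ((hV i _ (mem_punctured_ball (hsub ht) hw)).differentiableAt
        one_ne_zero).hasFDerivAt.comp_hasDerivAt t h1)
    (fun t ht w hw => by
      refine ContinuousAt.continuousWithinAt 
        (tendsto_finsetSum _ fun i _ => ContinuousAt.mul ?_ (by fun_prop))
      exact (hV i _ (mem_punctured_ball (hsub ht) hw)).continuousAt.comp
        (f := fun w => x₀ + t • w) (by fun_prop))
    (fun q hq => by
      refine ContinuousAt.continuousWithinAt 
        (tendsto_finsetSum _ fun i _ => ContinuousAt.mul ?_ (by fun_prop))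
      exact ((hV i _ (mem_punctured_ball (hsub hq.1) hq.2)).continuousAt_fderiv_of_one.comp
        (f := fun q : ℝ × Euc n => x₀ + q.1 • q.2) (by fun_prop)).clm_apply (by fun_prop))
  have h := (hasDerivAt_pow (n - 1) s).mul hI
  refine h.congr_deriv ?_
  have hpartial := radial_deriv_eq_of_div_eq_zero hV hdiv hs
  obtain ⟨m, rfl⟩ : ∃ m, n = m + 2 := ⟨n - 2, by omega⟩
  simp only [show m + 2 - 1 = m + 1 by omega, Nat.add_sub_cancel]
  push_cast at hpartial ⊢
  linear_combination s ^ m * hpartial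

theorem sphereFlux_eq {n : ℕ} (hn : 2 ≤ n) {x₀ : Euc n} {R r s : ℝ} {V : Fin n → Euc n → ℝ}
    (hV : ∀ i, ∀ x ∈ ball x₀ R \ {x₀}, ContDiffAt ℝ 1 (V i) x)
    (hdiv : ∀ x ∈ ball x₀ R \ {x₀}, ∑ i, fderiv ℝ (V i) x (EuclideanSpace.single i 1) = 0)
    (hr : r ∈ Set.Ioo 0 R) (hs : s ∈ Set.Ioo 0 R) : sphereFlux V x₀ r = sphereFlux V x₀ s :=
  isOpen_Ioo.is_const_of_deriv_eq_zero isPreconnected_Ioo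
    (fun _ ht => (hasDerivAt_sphereFlux hn hV hdiv ht).differentiableAt.differentiableWithinAt)
    (fun _ ht => (hasDerivAt_sphereFlux hn hV hdiv ht).deriv) hr hs

/-- The `i`-th partial derivative. -/
def partialDeriv {n : ℕ} (i : Fin n) (f : Euc n → ℝ) (x : Euc n) : ℝ :=
  fderiv ℝ f x (EuclideanSpace.single i 1)

theorem lap_eq_sum_partialDeriv {n : ℕ} (f : Euc n → ℝ) (x : Euc n) :
    lap n f x = ∑ i, partialDeriv i (partialDeriv i f) x := rfl

theorem contDiffAt_partialDeriv {n : ℕ} {f : Euc n → ℝ} {x : Euc n} (hf : ContDiffAt ℝ 2 f x)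
    (i : Fin n) : ContDiffAt ℝ 1 (partialDeriv i f) x :=
  (hf.fderiv_right (m := 1) (by norm_num)).clm_apply contDiffAt_const

theorem partialDeriv_comm {n : ℕ} {f : Euc n → ℝ} {x : Euc n} (hf : ContDiffAt ℝ 2 f x)
    (i k : Fin n) : partialDeriv i (partialDeriv k f) x = partialDeriv k (partialDeriv i f) x := by
  have hd : DifferentiableAt ℝ (fderiv ℝ f) x :=
    (hf.fderiv_right (m := 1) (by norm_num)).differentiableAt one_ne_zero
  have h (i k : Fin n) : partialDeriv i (partialDeriv k f) x
      = fderiv ℝ (fderiv ℝ f) x (EuclideanSpace.single i 1) (EuclideanSpace.single k 1) := by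
    unfold partialDeriv
    rw [fderiv_clm_apply hd (differentiableAt_const _)]
    simp
  rw [h, h]
  exact (hf.isSymmSndFDerivAt (by simp)) _ _

theorem partialDeriv_congr {n : ℕ} {f g : Euc n → ℝ} {x : Euc n} (h : f =ᶠ[𝓝 x] g) (i : Fin n) :
    partialDeriv i f x = partialDeriv i g x := by
  rw [partialDeriv, h.fderiv_eq, partialDeriv]

/-- The divergence-free tensor field whose flux is the Pohozaev boundary integral. -/
def stress {n : ℕ} (p : ℝ) (G Gt : Euc n → ℝ) (j i : Fin n) (x : Euc n) : ℝ :=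
  partialDeriv i Gt x * partialDeriv j G x + partialDeriv i G x * partialDeriv j Gt x
    + (if i = j then 1 else 0)
      * ((1 / (p + 1)) * G x ^ (p + 1) - ∑ k, partialDeriv k G x * partialDeriv k Gt x)

theorem contDiffAt_stress {n : ℕ} {p : ℝ} {G Gt : Euc n → ℝ} {x : Euc n} (hG : ContDiffAt ℝ 2 G x)
    (hGt : ContDiffAt ℝ 2 Gt x) (hpos : 0 < G x) (j i : Fin n) :
    ContDiffAt ℝ 1 (stress p G Gt j i) x := by
  have h1 := contDiffAt_partialDeriv hG
  have h2 := contDiffAt_partialDeriv hGt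
  have h3 : ContDiffAt ℝ 1 (fun x => G x ^ (p + 1)) x :=
    (hG.of_le (by norm_num)).rpow_const_of_ne hpos.ne'
  exact (((h2 i).mul (h1 j)).add ((h1 i).mul (h2 j))).add
    (contDiffAt_const.mul ((contDiffAt_const.mul h3).sub
      (ContDiffAt.sum fun k _ => (h1 k).mul (h2 k))))

theorem partialDeriv_stress {n : ℕ} {p : ℝ} (hp : 0 < p) {G Gt : Euc n → ℝ} {x : Euc n}
    (hG : ContDiffAt ℝ 2 G x) (hGt : ContDiffAt ℝ 2 Gt x) (hpos : 0 < G x) (j i : Fin n) :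
    partialDeriv i (stress p G Gt j i) x
      = partialDeriv i (partialDeriv i Gt) x * partialDeriv j G x
        + partialDeriv i Gt x * partialDeriv i (partialDeriv j G) x
        + (partialDeriv i (partialDeriv i G) x * partialDeriv j Gt x
          + partialDeriv i G x * partialDeriv i (partialDeriv j Gt) x)
        + if i = j then G x ^ p * partialDeriv i G x
          - ∑ k, (partialDeriv i (partialDeriv k G) x * partialDeriv k Gt x
            + partialDeriv k G x * partialDeriv i (partialDeriv k Gt) x) else 0 := by
  have h1 (k : Fin n) := ((contDiffAt_partialDeriv hG k).differentiableAt one_ne_zero).hasFDerivAt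
  have h2 (k : Fin n) := ((contDiffAt_partialDeriv hGt k).differentiableAt one_ne_zero).hasFDerivAt
  have h3 := (hG.differentiableAt two_ne_zero).hasFDerivAt.rpow_const (p := p + 1) (Or.inl hpos.ne')
  have h := (((h2 i).mul (h1 j)).add ((h1 i).mul (h2 j))).add
    (((h3.const_mul (1 / (p + 1))).sub
      (HasFDerivAt.fun_sum fun k (_ : k ∈ Finset.univ) => (h1 k).mul (h2 k))).const_mul
        (if i = j then (1 : ℝ) else 0))
  have hp' : p + 1 ≠ 0 := by positivity
  rw [partialDeriv, HasFDerivAt.fderiv (f := stress p G Gt j i) h]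
  simp only [add_apply, sub_apply,
    smul_apply, sum_apply, smul_eq_mul, add_sub_cancel_right]
  change partialDeriv i Gt x * partialDeriv i (partialDeriv j G) x
    + partialDeriv j G x * partialDeriv i (partialDeriv i Gt) x
    + (partialDeriv i G x * partialDeriv i (partialDeriv j Gt) x
    + partialDeriv j Gt x * partialDeriv i (partialDeriv i G) x)
    + (if i = j then (1 : ℝ) else 0) * (1 / (p + 1) * ((p + 1) * G x ^ p * partialDeriv i G x)
      - ∑ k, (partialDeriv k G x * partialDeriv i (partialDeriv k Gt) x
        + partialDeriv k Gt x * partialDeriv i (partialDeriv k G) x)) = _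
  have hsum : ∑ k, (partialDeriv k G x * partialDeriv i (partialDeriv k Gt) x
        + partialDeriv k Gt x * partialDeriv i (partialDeriv k G) x)
      = ∑ k, (partialDeriv i (partialDeriv k G) x * partialDeriv k Gt x
            + partialDeriv k G x * partialDeriv i (partialDeriv k Gt) x) :=
    Finset.sum_congr rfl fun k _ => by ring
  rw [hsum]
  split_ifs
  · field_simp
    ring
  · ring

theorem div_stress_eq_zero {n : ℕ} {p : ℝ} (hp : 0 < p) {G Gt : Euc n → ℝ} {x : Euc n}
    (hG : ContDiffAt ℝ 2 G x) (hGt : ContDiffAt ℝ 2 Gt x) (hpos : 0 < G x)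
    (hlap : lap n G x = 0) (hlapt : -lap n Gt x = G x ^ p) (j : Fin n) :
    ∑ i, fderiv ℝ (stress p G Gt j i) x (EuclideanSpace.single i 1) = 0 := by
  change ∑ i, partialDeriv i (stress p G Gt j i) x = 0
  rw [lap_eq_sum_partialDeriv] at hlap hlapt
  simp only [partialDeriv_stress hp hG hGt hpos, Finset.sum_add_distrib, ← Finset.sum_mul,
    Finset.sum_ite_eq', Finset.mem_univ, if_true, hlap, ← hlapt]
  have h1 : ∑ k, partialDeriv k Gt x * partialDeriv k (partialDeriv j G) x
      = ∑ k, partialDeriv j (partialDeriv k G) x * partialDeriv k Gt x :=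
    Finset.sum_congr rfl fun k _ => by rw [partialDeriv_comm hG k j, mul_comm]
  have h2 : ∑ k, partialDeriv k G x * partialDeriv k (partialDeriv j Gt) x
      = ∑ k, partialDeriv k G x * partialDeriv j (partialDeriv k Gt) x :=
    Finset.sum_congr rfl fun k _ => by rw [partialDeriv_comm hGt k j]
  rw [h1, h2]
  ring

theorem sum_stress_mul {n : ℕ} (p : ℝ) (G Gt : Euc n → ℝ) (j : Fin n) (x w : Euc n) :
    ∑ i, stress p G Gt j i x * w i
      = (fderiv ℝ Gt x w * partialDeriv j G x + fderiv ℝ G x w * partialDeriv j Gt x)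
        - (∑ k, partialDeriv k G x * partialDeriv k Gt x) * w j
        + (1 / (p + 1)) * (G x ^ (p + 1) * w j) := by
  have h (i : Fin n) : stress p G Gt j i x * w i
      = (w i * partialDeriv i Gt x) * partialDeriv j G x
        + (w i * partialDeriv i G x) * partialDeriv j Gt x
        + if i = j then ((1 / (p + 1)) * G x ^ (p + 1)
          - ∑ k, partialDeriv k G x * partialDeriv k Gt x) * w i else 0 := by
    unfold stress
    split_ifs <;> ring
  rw [clm_apply_eq_sum_single (fderiv ℝ Gt x) w, clm_apply_eq_sum_single (fderiv ℝ G x) w]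
  simp only [h, Finset.sum_add_distrib, ← Finset.sum_mul, Finset.sum_ite_eq', Finset.mem_univ,
    if_true]
  unfold partialDeriv
  ring

theorem inner_gradient_eq_sum {n : ℕ} (f g : Euc n → ℝ) (x : Euc n) :
    ⟪gradient f x, gradient g x⟫ = ∑ k, partialDeriv k f x * partialDeriv k g x := by
  have h (f : Euc n → ℝ) (k : Fin n) : gradient f x k = partialDeriv k f x := by
    have := InnerProductSpace.toDual_symm_apply (𝕜 := ℝ) (x := EuclideanSpace.single k (1 : ℝ))
      (y := fderiv ℝ f x)
    rw [EuclideanSpace.inner_single_right] at this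
    simpa [gradient, partialDeriv] using this
  rw [PiLp.inner_apply]
  refine Finset.sum_congr rfl fun k _ => ?_
  rw [h, h]
  simp [mul_comm]

theorem hasFDerivAt_norm_sub_rpow {n : ℕ} {x₀ x : Euc n} (hx : x ≠ x₀) (a : ℝ) :
    HasFDerivAt (fun y => ‖y - x₀‖ ^ a) ((a * ‖x - x₀‖ ^ (a - 2)) • innerSL ℝ (x - x₀)) x := by
  have hx' : x - x₀ ≠ 0 := sub_ne_zero.2 hx
  have hn : 0 < ‖x - x₀‖ := norm_pos_iff.2 hx'
  have h := (((hasFDerivAt_id x).sub_const x₀).norm_sq).rpow_const (p := a / 2)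
    (Or.inl (by simpa using hx'))
  convert! h using 1
  · funext y
    rw [← Real.rpow_natCast_mul (norm_nonneg _)]
    congr 1
    push_cast
    ring
  · ext v
    simp only [id, smul_apply, smul_eq_mul, ContinuousLinearMap.comp_apply,
      ContinuousLinearMap.id_apply, nsmul_eq_mul]
    rw [← Real.rpow_natCast_mul (norm_nonneg _)]
    push_cast
    ring_nf

theorem contDiffAt_norm_sub_rpow {n : ℕ} {x₀ x : Euc n} (hx : x ≠ x₀) (a : ℝ) :
    ContDiffAt ℝ 2 (fun y => ‖y - x₀‖ ^ a) x := by
  have hx' : x - x₀ ≠ 0 := sub_ne_zero.2 hx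
  exact ((contDiffAt_id.sub contDiffAt_const).norm ℝ hx').rpow_const_of_ne (norm_ne_zero_iff.2 hx')

theorem partialDeriv_norm_sub_rpow {n : ℕ} {x₀ x : Euc n} (hx : x ≠ x₀) (a : ℝ) (i : Fin n) :
    partialDeriv i (fun y => ‖y - x₀‖ ^ a) x = a * ‖x - x₀‖ ^ (a - 2) * (x i - x₀ i) := by
  rw [partialDeriv, (hasFDerivAt_norm_sub_rpow hx a).fderiv]
  simp [EuclideanSpace.inner_single_right]

theorem lap_norm_sub_rpow {n : ℕ} {x₀ x : Euc n} (hx : x ≠ x₀) (a : ℝ) :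
    lap n (fun y => ‖y - x₀‖ ^ a) x = a * (a - 2 + n) * ‖x - x₀‖ ^ (a - 2) := by
  have hn : 0 < ‖x - x₀‖ := norm_pos_iff.2 (sub_ne_zero.2 hx)
  have h (i : Fin n) : partialDeriv i (partialDeriv i fun y => ‖y - x₀‖ ^ a) x
      = a * (a - 2) * ‖x - x₀‖ ^ (a - 2 - 2) * (x - x₀) i ^ 2 + a * ‖x - x₀‖ ^ (a - 2) := by
    have hev : partialDeriv i (fun y => ‖y - x₀‖ ^ a)
        =ᶠ[𝓝 x] fun y => a * ‖y - x₀‖ ^ (a - 2) * (y i - x₀ i) := by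
      filter_upwards [isOpen_ne.mem_nhds hx] with y hy using partialDeriv_norm_sub_rpow hy a i
    have hi : HasFDerivAt (fun y : Euc n => y i - x₀ i) (EuclideanSpace.proj i : Euc n →L[ℝ] ℝ) x :=
      (EuclideanSpace.proj i : Euc n →L[ℝ] ℝ).hasFDerivAt.sub_const _
    rw [partialDeriv_congr hev, partialDeriv, HasFDerivAt.fderiv
      (f := fun y => a * ‖y - x₀‖ ^ (a - 2) * (y i - x₀ i))
      (((hasFDerivAt_norm_sub_rpow hx (a - 2)).const_mul a).mul hi)]
    simp [EuclideanSpace.inner_single_right]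
    ring
  have h2 : ‖x - x₀‖ ^ (a - 2 - 2) * ‖x - x₀‖ ^ 2 = ‖x - x₀‖ ^ (a - 2) := by
    rw [← Real.rpow_natCast, ← Real.rpow_add hn]
    norm_num
  rw [lap_eq_sum_partialDeriv]
  simp only [h, Finset.sum_add_distrib, ← Finset.mul_sum, ← EuclideanSpace.real_norm_sq_eq,
    Finset.sum_const, Finset.card_univ, Fintype.card_fin, nsmul_eq_mul]
  linear_combination a * (a - 2) * h2

theorem partialDeriv_const_mul_sub {n : ℕ} {u H : Euc n → ℝ} {x : Euc n}
    (hu : DifferentiableAt ℝ u x) (hH : DifferentiableAt ℝ H x) (c : ℝ) (i : Fin n) :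
    partialDeriv i (fun y => c * u y - H y) x = c * partialDeriv i u x - partialDeriv i H x := by
  rw [partialDeriv, HasFDerivAt.fderiv (f := fun y => c * u y - H y)
    ((hu.hasFDerivAt.const_mul c).sub hH.hasFDerivAt)]
  rfl

theorem lap_const_mul_sub {n : ℕ} {u H : Euc n → ℝ} {x : Euc n} (hu : ContDiffAt ℝ 2 u x)
    (hH : ContDiffAt ℝ 2 H x) (c : ℝ) :
    lap n (fun y => c * u y - H y) x = c * lap n u x - lap n H x := by
  have h (i : Fin n) : partialDeriv i (fun y => c * u y - H y)
      =ᶠ[𝓝 x] fun y => c * partialDeriv i u y - partialDeriv i H y := by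
    filter_upwards [hu.eventually (by simp), hH.eventually (by simp)] with y hy hy'
    exact partialDeriv_const_mul_sub (hy.differentiableAt two_ne_zero)
      (hy'.differentiableAt two_ne_zero) c i
  simp only [lap_eq_sum_partialDeriv]
  rw [Finset.mul_sum, ← Finset.sum_sub_distrib]
  refine Finset.sum_congr rfl fun i _ => ?_
  rw [partialDeriv_congr (h i), partialDeriv_const_mul_sub
    ((contDiffAt_partialDeriv hu i).differentiableAt one_ne_zero)
    ((contDiffAt_partialDeriv hH i).differentiableAt one_ne_zero)]

theorem abs_rpow_add_one_sub_le {p x y C : ℝ} (hp : 0 ≤ p) (hx : 0 ≤ x) (hy : 0 ≤ y) (hxC : x ≤ C)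
    (hyC : y ≤ C) : |x ^ (p + 1) - y ^ (p + 1)| ≤ (p + 1) * C ^ p * |x - y| := by
  refine (convex_Icc 0 C).norm_image_sub_le_of_norm_hasDerivWithin_le
    (f := fun t : ℝ => t ^ (p + 1)) (f' := fun t => (p + 1) * t ^ (p + 1 - 1))
    (fun t _ => (Real.hasDerivAt_rpow_const (Or.inr (by linarith))).hasDerivWithinAt)
    (fun t ht => ?_) ⟨hy, hyC⟩ ⟨hx, hxC⟩
  have := Real.rpow_nonneg ht.1 p
  rw [add_sub_cancel_right, Real.norm_of_nonneg (by positivity)]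
  gcongr
  exacts [ht.1, ht.2]

theorem sum_stress_mul_of_singular {n : ℕ} {p c α a b s : ℝ} {x₀ w : Euc n}
    {H Ht G Gt : Euc n → ℝ}
    (hG : ∀ x, x ≠ x₀ → G x = c * ‖x - x₀‖ ^ a - H x)
    (hGt : ∀ x, x ≠ x₀ → Gt x = α * ‖x - x₀‖ ^ b - Ht x)
    (hs : 0 < s) (hw : w ∈ sphere (0 : Euc n) 1)
    (hH : DifferentiableAt ℝ H (x₀ + s • w)) (hHt : DifferentiableAt ℝ Ht (x₀ + s • w))
    (j : Fin n) :
    ∑ i, stress p G Gt j i (x₀ + s • w) * w i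
      = c * (a * s ^ (a - 1)) * (α * (b * s ^ (b - 1))) * w j
        - α * (b * s ^ (b - 1)) * partialDeriv j H (x₀ + s • w)
        - c * (a * s ^ (a - 1)) * partialDeriv j Ht (x₀ + s • w)
        + (fderiv ℝ Ht (x₀ + s • w) w * partialDeriv j H (x₀ + s • w)
          + fderiv ℝ H (x₀ + s • w) w * partialDeriv j Ht (x₀ + s • w)
          - (∑ k, partialDeriv k H (x₀ + s • w) * partialDeriv k Ht (x₀ + s • w)) * w j)
        + (1 / (p + 1)) * ((c * s ^ a - H (x₀ + s • w)) ^ (p + 1) * w j) := by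
  have hw' : ‖w‖ = 1 := by simpa using hw
  have hw2 := sum_sq_eq_one_of_mem_sphere hw
  have hx : x₀ + s • w ≠ x₀ :=
    (mem_punctured_ball (x₀ := x₀) (R := s + 1) ⟨hs, by linarith⟩ hw).2
  have hns : ‖x₀ + s • w - x₀‖ = s := by
    rw [add_sub_cancel_left, norm_smul, hw', Real.norm_of_nonneg hs.le, mul_one]
  have hpartial {c a : ℝ} {F K : Euc n → ℝ} (hF : ∀ x, x ≠ x₀ → F x = c * ‖x - x₀‖ ^ a - K x)
      (hK : DifferentiableAt ℝ K (x₀ + s • w)) (i : Fin n) :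
      partialDeriv i F (x₀ + s • w)
        = c * (a * s ^ (a - 1)) * w i - partialDeriv i K (x₀ + s • w) := by
    have hev : F =ᶠ[𝓝 (x₀ + s • w)] fun y => c * ‖y - x₀‖ ^ a - K y := by
      filter_upwards [isOpen_ne.mem_nhds hx] with y hy using hF y hy
    have hpow : s ^ (a - 1) = s ^ (a - 2) * s := by
      rw [← Real.rpow_add_one hs.ne']
      ring_nf
    rw [partialDeriv_congr hev, partialDeriv_const_mul_sub
      (hasFDerivAt_norm_sub_rpow hx a).differentiableAt hK, partialDeriv_norm_sub_rpow hx, hns, hpow]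
    simp
    ring
  have hrad {c' : ℝ} {F K : Euc n → ℝ} (h : ∀ i, partialDeriv i F (x₀ + s • w)
      = c' * w i - partialDeriv i K (x₀ + s • w)) :
      fderiv ℝ F (x₀ + s • w) w = c' - fderiv ℝ K (x₀ + s • w) w := by
    rw [clm_apply_eq_sum_single, clm_apply_eq_sum_single (fderiv ℝ K (x₀ + s • w)),
      eq_sub_iff_add_eq, ← Finset.sum_add_distrib]
    calc _ = ∑ k, c' * (w k * w k) := Finset.sum_congr rfl fun k _ => by
          have := h k
          unfold partialDeriv at this
          rw [this]
          ring
      _ = c' := by rw [← Finset.mul_sum, hw2, mul_one]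
  have hprod {c₁ c₂ : ℝ} : ∑ k, (c₁ * w k - partialDeriv k H (x₀ + s • w))
      * (c₂ * w k - partialDeriv k Ht (x₀ + s • w))
      = c₁ * c₂ - c₁ * fderiv ℝ Ht (x₀ + s • w) w - c₂ * fderiv ℝ H (x₀ + s • w) w
        + ∑ k, partialDeriv k H (x₀ + s • w) * partialDeriv k Ht (x₀ + s • w) := by
    have h1 : c₁ * c₂ = ∑ k, c₁ * c₂ * (w k * w k) := by rw [← Finset.mul_sum, hw2, mul_one]
    rw [clm_apply_eq_sum_single (fderiv ℝ Ht (x₀ + s • w)),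
      clm_apply_eq_sum_single (fderiv ℝ H (x₀ + s • w)), h1]
    simp only [Finset.mul_sum, ← Finset.sum_add_distrib, ← Finset.sum_sub_distrib]
    refine Finset.sum_congr rfl fun k _ => ?_
    unfold partialDeriv
    ring
  rw [sum_stress_mul, hrad (hpartial hG hH), hrad (hpartial hGt hHt), hpartial hG hH, hpartial hGt hHt]
  simp only [hpartial hG hH, hpartial hGt hHt]
  rw [hprod, hG _ hx, hns]
  ring

/-- The rescaled flux density, with its odd singular part removed, converges uniformly
on the unit sphere. -/
theorem eventually_flux_density_sub_le {n : ℕ} (hn : 3 ≤ n) {p c α R : ℝ} (hp : 0 < p)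
    (hp2 : ((n : ℝ) - 2) * p < n - 1) (hc : 0 ≤ c) (hR : 0 < R) {x₀ : Euc n}
    {H Ht G Gt : Euc n → ℝ} (hH : ContDiffOn ℝ 1 H (ball x₀ R))
    (hHt : ContDiffOn ℝ 1 Ht (ball x₀ R))
    (hG : ∀ x, x ≠ x₀ → G x = c * ‖x - x₀‖ ^ ((2 : ℝ) - n) - H x)
    (hGt : ∀ x, x ≠ x₀ → Gt x = α * ‖x - x₀‖ ^ (-(((n : ℝ) - 2) * p - 2)) - Ht x)
    (hGpos : ∀ x ∈ ball x₀ R, x ≠ x₀ → 0 < G x) (j : Fin n) {ε : ℝ} (hε : 0 < ε) :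
    ∃ A : ℝ → ℝ, ∀ᶠ s in 𝓝[>] (0 : ℝ), ∀ w ∈ sphere (0 : Euc n) 1,
      |s ^ (n - 1) * (∑ i, stress p G Gt j i (x₀ + s • w) * w i - A s * w j)
        - ((n : ℝ) - 2) * c * partialDeriv j Ht x₀| ≤ ε := by
  have hn' : (3 : ℝ) ≤ n := by exact_mod_cast hn
  have hdH := hH.continuousOn_fderiv_of_isOpen isOpen_ball le_rfl
  have hdHt := hHt.continuousOn_fderiv_of_isOpen isOpen_ball le_rfl
  obtain ⟨M, hM⟩ := (isCompact_closedBall x₀ (R / 2)).exists_bound_of_continuousOn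
    (f := fun x => ‖fderiv ℝ H x‖ + ‖fderiv ℝ Ht x‖ + |H x|)
    (((hdH.norm.add hdHt.norm).add hH.continuousOn.abs).mono
      (closedBall_subset_ball (by linarith)))
  have hM' : ∀ x ∈ closedBall x₀ (R / 2), ‖fderiv ℝ H x‖ ≤ M ∧ ‖fderiv ℝ Ht x‖ ≤ M ∧ |H x| ≤ M := by
    intro x hx
    have h := hM x hx
    have h1 := norm_nonneg (fderiv ℝ H x)
    have h2 := norm_nonneg (fderiv ℝ Ht x)
    have h3 := abs_nonneg (H x)
    rw [Real.norm_of_nonneg (by positivity)] at h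
    refine ⟨?_, ?_, ?_⟩ <;> linarith
  have hM0 : 0 ≤ M :=
    (abs_nonneg _).trans (hM' x₀ (mem_closedBall_self (by linarith))).2.2
  set b : ℝ := -(((n : ℝ) - 2) * p - 2) with hb
  let B : ℝ → ℝ := fun s => |α * b| * M * s ^ ((n : ℝ) - 2 + b) + (n + 2) * M ^ 2 * s ^ (n - 1)
    + M * (c + M * s ^ (n - 2)) ^ p * s ^ ((n : ℝ) - 1 - (n - 2) * p)
  have hB : Tendsto B (𝓝[>] 0) (𝓝 0) := by
    have hcont : ContinuousAt B 0 := by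
      have h1 : ContinuousAt (fun s : ℝ => s ^ ((n : ℝ) - 2 + b)) 0 :=
        Real.continuousAt_rpow_const _ _ (Or.inr (by linarith))
      have h2 : ContinuousAt (fun s : ℝ => s ^ ((n : ℝ) - 1 - (n - 2) * p)) 0 :=
        Real.continuousAt_rpow_const _ _ (Or.inr (by linarith))
      have h3 : ContinuousAt (fun s : ℝ => (c + M * s ^ (n - 2)) ^ p) 0 :=
        ContinuousAt.rpow_const (by fun_prop) (Or.inr hp.le)
      exact ((continuousAt_const.mul h1).add (by fun_prop)).add ((continuousAt_const.mul h3).mul h2)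
    have h0 : B 0 = 0 := by
      simp only [B]
      rw [Real.zero_rpow (by linarith), Real.zero_rpow (by linarith), zero_pow (by omega)]
      ring
    have h := hcont.tendsto
    rw [h0] at h
    exact h.mono_left nhdsWithin_le_nhds
  have hpd : ContinuousAt (partialDeriv j Ht) x₀ :=
    (hdHt.continuousAt (ball_mem_nhds x₀ hR)).clm_apply continuousAt_const
  have hδ : 0 < ε / (2 * (((n : ℝ) - 2) * c + 1)) :=
    div_pos hε (by nlinarith)
  obtain ⟨δ, hδ0, hδ'⟩ := Metric.continuousAt_iff.1 hpd _ hδ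
  refine ⟨fun s => c * ((2 - n) * s ^ ((2 : ℝ) - n - 1)) * (α * (b * s ^ (b - 1)))
    + (1 / (p + 1)) * (c * s ^ ((2 : ℝ) - n)) ^ (p + 1), ?_⟩
  have hsmall : Set.Ioo 0 (min δ (R / 2)) ∈ 𝓝[>] (0 : ℝ) :=
    Ioo_mem_nhdsGT (lt_min hδ0 (by linarith))
  filter_upwards [hsmall, hB.eventually_lt_const (half_pos hε)] with s hs hBs w hw
  have hs0 : 0 < s := hs.1
  have hsδ : s < δ := hs.2.trans_le (min_le_left _ _)
  have hsR : s < R / 2 := hs.2.trans_le (min_le_right _ _)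
  have hw' : ‖w‖ = 1 := by simpa using hw
  obtain ⟨hxR, hxne⟩ := mem_punctured_ball (x₀ := x₀) (R := R) ⟨hs0, by linarith⟩ hw
  have hns : ‖x₀ + s • w - x₀‖ = s := by
    rw [add_sub_cancel_left, norm_smul, hw', Real.norm_of_nonneg hs0.le, mul_one]
  set x := x₀ + s • w with hxdef
  have hxc : x ∈ closedBall x₀ (R / 2) := by
    rw [mem_closedBall_iff_norm, hns]
    exact hsR.le
  obtain ⟨hH1, hHt1, hH0⟩ := hM' x hxc
  have hwj : |w j| ≤ 1 := by
    rw [← hw', ← Real.norm_eq_abs]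
    exact PiLp.norm_apply_le w j
  have hbd {L : Euc n →L[ℝ] ℝ} (hL : ‖L‖ ≤ M) {v : Euc n} (hv : ‖v‖ = 1) : |L v| ≤ M := by
    have := L.le_opNorm v
    rw [hv, mul_one] at this
    exact this.trans hL
  have he (k : Fin n) : ‖EuclideanSpace.single k (1 : ℝ)‖ = 1 := by simp
  have hpH (k : Fin n) : |partialDeriv k H x| ≤ M := hbd hH1 (he k)
  have hpHt (k : Fin n) : |partialDeriv k Ht x| ≤ M := hbd hHt1 (he k)
  have hmod : (((n : ℝ) - 2) * c) * |partialDeriv j Ht x - partialDeriv j Ht x₀| ≤ ε / 2 := by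
    have h1 : |partialDeriv j Ht x - partialDeriv j Ht x₀| ≤ ε / (2 * (((n : ℝ) - 2) * c + 1)) :=
      (hδ' (by rwa [dist_eq_norm, hns])).le
    have h2 : 0 ≤ ((n : ℝ) - 2) * c := mul_nonneg (by linarith) hc
    calc _ ≤ (((n : ℝ) - 2) * c + 1) * (ε / (2 * (((n : ℝ) - 2) * c + 1))) := by
          gcongr
          linarith
      _ = ε / 2 := by field_simp
  have hcross : |fderiv ℝ Ht x w * partialDeriv j H x + fderiv ℝ H x w * partialDeriv j Ht x
      - (∑ k, partialDeriv k H x * partialDeriv k Ht x) * w j| ≤ (n + 2) * M ^ 2 := by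
    have h1 : |fderiv ℝ Ht x w * partialDeriv j H x| ≤ M * M := by
      rw [abs_mul]
      exact mul_le_mul (hbd hHt1 hw') (hpH j) (abs_nonneg _) hM0
    have h2 : |fderiv ℝ H x w * partialDeriv j Ht x| ≤ M * M := by
      rw [abs_mul]
      exact mul_le_mul (hbd hH1 hw') (hpHt j) (abs_nonneg _) hM0
    have h3 : |∑ k, partialDeriv k H x * partialDeriv k Ht x| ≤ n * (M * M) := by
      refine (Finset.abs_sum_le_sum_abs _ _).trans ((Finset.sum_le_card_nsmul _ _ (M * M)
        fun k _ => ?_).trans_eq (by simp))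
      rw [abs_mul]
      exact mul_le_mul (hpH k) (hpHt k) (abs_nonneg _) hM0
    have h4 : |(∑ k, partialDeriv k H x * partialDeriv k Ht x) * w j| ≤ n * (M * M) := by
      rw [abs_mul]
      exact (mul_le_of_le_one_right (abs_nonneg _) hwj).trans h3
    calc _ ≤ M * M + M * M + n * (M * M) :=
          (abs_sub _ _).trans (add_le_add ((abs_add_le _ _).trans (add_le_add h1 h2)) h4)
      _ = _ := by ring
  have hsn : s ^ (n - 1) = s ^ ((n : ℝ) - 1) := by
    rw [← Real.rpow_natCast, Nat.cast_sub (by omega), Nat.cast_one]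
  have hsn2 : s ^ (n - 2) = s ^ ((n : ℝ) - 2) := by
    rw [← Real.rpow_natCast, Nat.cast_sub (by omega), Nat.cast_ofNat]
  have hg1 : s ^ (n - 1) * s ^ ((2 : ℝ) - n - 1) = 1 := by
    rw [hsn, ← Real.rpow_add hs0]
    ring_nf
    exact Real.rpow_zero s
  have hh1 : s ^ (n - 1) * s ^ (b - 1) = s ^ ((n : ℝ) - 2 + b) := by
    rw [hsn, ← Real.rpow_add hs0]
    ring_nf
  have hgM : s ^ (n - 1) * (c * s ^ ((2 : ℝ) - n) + M) ^ p
      = (c + M * s ^ (n - 2)) ^ p * s ^ ((n : ℝ) - 1 - (n - 2) * p) := by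
    have h1 : c * s ^ ((2 : ℝ) - n) + M = (c + M * s ^ (n - 2)) * s ^ ((2 : ℝ) - n) := by
      rw [add_mul, mul_assoc M, hsn2, ← Real.rpow_add hs0]
      simp
    rw [h1, Real.mul_rpow (by positivity) (by positivity), hsn, ← Real.rpow_mul hs0.le,
      mul_left_comm, ← Real.rpow_add hs0]
    ring_nf
  have hpow : |(c * s ^ ((2 : ℝ) - n) - H x) ^ (p + 1) - (c * s ^ ((2 : ℝ) - n)) ^ (p + 1)|
      ≤ (p + 1) * (c * s ^ ((2 : ℝ) - n) + M) ^ p * M := by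
    have hpos := hGpos x hxR hxne
    rw [hG x hxne, hns] at hpos
    have hH0' := abs_le.1 hH0
    refine (abs_rpow_add_one_sub_le (C := c * s ^ ((2 : ℝ) - n) + M) hp.le hpos.le (by positivity)
      (by linarith) (by linarith)).trans ?_
    rw [sub_sub_cancel_left, abs_neg]
    gcongr
  rw [sum_stress_mul_of_singular hG hGt hs0 hw
    ((hH.contDiffAt (isOpen_ball.mem_nhds hxR)).differentiableAt one_ne_zero)
    ((hHt.contDiffAt (isOpen_ball.mem_nhds hxR)).differentiableAt one_ne_zero)]
  rw [← hxdef]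
  have hsplit : s ^ (n - 1) * (c * ((2 - n) * s ^ ((2 : ℝ) - n - 1)) * (α * (b * s ^ (b - 1))) * w j
        - α * (b * s ^ (b - 1)) * partialDeriv j H x
        - c * ((2 - n) * s ^ ((2 : ℝ) - n - 1)) * partialDeriv j Ht x
        + (fderiv ℝ Ht x w * partialDeriv j H x + fderiv ℝ H x w * partialDeriv j Ht x
          - (∑ k, partialDeriv k H x * partialDeriv k Ht x) * w j)
        + (1 / (p + 1)) * ((c * s ^ ((2 : ℝ) - n) - H x) ^ (p + 1) * w j)
        - (c * ((2 - n) * s ^ ((2 : ℝ) - n - 1)) * (α * (b * s ^ (b - 1)))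
          + (1 / (p + 1)) * (c * s ^ ((2 : ℝ) - n)) ^ (p + 1)) * w j)
        - ((n : ℝ) - 2) * c * partialDeriv j Ht x₀
      = ((n : ℝ) - 2) * c * (partialDeriv j Ht x - partialDeriv j Ht x₀)
        + -(α * b * s ^ ((n : ℝ) - 2 + b) * partialDeriv j H x)
        + s ^ (n - 1) * (fderiv ℝ Ht x w * partialDeriv j H x + fderiv ℝ H x w * partialDeriv j Ht x
          - (∑ k, partialDeriv k H x * partialDeriv k Ht x) * w j)
        + s ^ (n - 1) * ((1 / (p + 1)) * (((c * s ^ ((2 : ℝ) - n) - H x) ^ (p + 1)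
          - (c * s ^ ((2 : ℝ) - n)) ^ (p + 1)) * w j)) := by
    linear_combination ((n : ℝ) - 2) * c * partialDeriv j Ht x * hg1
      - α * b * partialDeriv j H x * hh1
  rw [hsplit]
  have e1 : |((n : ℝ) - 2) * c * (partialDeriv j Ht x - partialDeriv j Ht x₀)| ≤ ε / 2 := by
    rwa [abs_mul, abs_of_nonneg (mul_nonneg (by linarith) hc)]
  have e2 : |-(α * b * s ^ ((n : ℝ) - 2 + b) * partialDeriv j H x)|
      ≤ |α * b| * M * s ^ ((n : ℝ) - 2 + b) := by
    rw [abs_neg, abs_mul, abs_mul, abs_of_nonneg (Real.rpow_nonneg hs0.le _), mul_right_comm]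
    gcongr
    exact hpH j
  have e3 : |s ^ (n - 1) * (fderiv ℝ Ht x w * partialDeriv j H x
      + fderiv ℝ H x w * partialDeriv j Ht x
      - (∑ k, partialDeriv k H x * partialDeriv k Ht x) * w j)| ≤ (n + 2) * M ^ 2 * s ^ (n - 1) := by
    rw [abs_mul, abs_of_nonneg (by positivity), mul_comm]
    gcongr
  have e4 : |s ^ (n - 1) * ((1 / (p + 1)) * (((c * s ^ ((2 : ℝ) - n) - H x) ^ (p + 1)
      - (c * s ^ ((2 : ℝ) - n)) ^ (p + 1)) * w j))|
      ≤ M * (c + M * s ^ (n - 2)) ^ p * s ^ ((n : ℝ) - 1 - (n - 2) * p) := by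
    rw [mul_assoc M, ← hgM, abs_mul, abs_mul, abs_mul,
      abs_of_nonneg (by positivity : 0 ≤ s ^ (n - 1)),
      abs_of_nonneg (by positivity : 0 ≤ 1 / (p + 1))]
    calc _ ≤ s ^ (n - 1) * ((1 / (p + 1))
          * ((p + 1) * (c * s ^ ((2 : ℝ) - n) + M) ^ p * M * 1)) := by gcongr
      _ = _ := by field_simp
  have htri := (abs_add_le _ _).trans (add_le_add ((abs_add_le _ _).trans (add_le_add
    ((abs_add_le _ _).trans (add_le_add e1 e2)) e3)) e4)
  simp only [B] at hBs
  linarith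

theorem lap_congr {n : ℕ} {f g : Euc n → ℝ} {x : Euc n} (h : f =ᶠ[𝓝 x] g) :
    lap n f x = lap n g x :=
  Finset.sum_congr rfl fun i _ =>
    partialDeriv_congr (h.eventuallyEq_nhds.mono fun _ hy => partialDeriv_congr hy i) i

theorem sphere_integrals_eq_sphereFlux {n : ℕ} (hn : 1 ≤ n) {p r R : ℝ} {x₀ : Euc n}
    {G Gt : Euc n → ℝ} (hr : r ∈ Set.Ioo 0 R)
    (hG : ∀ x ∈ ball x₀ R \ {x₀}, ContDiffAt ℝ 1 G x)
    (hGt : ∀ x ∈ ball x₀ R \ {x₀}, ContDiffAt ℝ 1 Gt x)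
    (hpos : ∀ x ∈ ball x₀ R \ {x₀}, 0 < G x) (j : Fin n) :
    (∫ x in sphere x₀ r,
        (fderiv ℝ Gt x (r⁻¹ • (x - x₀)) * fderiv ℝ G x (EuclideanSpace.single j 1)
          + fderiv ℝ G x (r⁻¹ • (x - x₀)) * fderiv ℝ Gt x (EuclideanSpace.single j 1))
        ∂(surf n))
      - (∫ x in sphere x₀ r, ⟪gradient G x, gradient Gt x⟫ * ((x j - x₀ j) / r) ∂(surf n))
      + (1 / (p + 1)) *
          ∫ x in sphere x₀ r, (G x) ^ (p + 1) * ((x j - x₀ j) / r) ∂(surf n)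
      = sphereFlux (stress p G Gt j) x₀ r := by
  have hν (w : Euc n) : r⁻¹ • (x₀ + r • w - x₀) = w := by
    rw [add_sub_cancel_left, inv_smul_smul₀ hr.1.ne']
  have hνj (w : Euc n) : ((x₀ + r • w) j - x₀ j) / r = w j := by
    rw [PiLp.add_apply, PiLp.smul_apply, smul_eq_mul, add_sub_cancel_left,
      mul_div_cancel_left₀ _ hr.1.ne']
  have hcomp {F : Type} [TopologicalSpace F] {f : Euc n → F}
      (hf : ∀ x ∈ ball x₀ R \ {x₀}, ContinuousAt f x) :
      ContinuousOn (fun w => f (x₀ + r • w)) (sphere 0 1) := fun w hw =>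
    (ContinuousAt.comp (f := fun w => x₀ + r • w) (hf _ (mem_punctured_ball hr hw))
      (by fun_prop)).continuousWithinAt
  have hdG := hcomp fun x hx => (hG x hx).continuousAt_fderiv_of_one
  have hdGt := hcomp fun x hx => (hGt x hx).continuousAt_fderiv_of_one
  have hpow := hcomp fun x hx =>
    (hG x hx).continuousAt.rpow_const (p := p + 1) (Or.inl (hpos x hx).ne')
  have hpG (k : Fin n) : ContinuousOn (fun w => partialDeriv k G (x₀ + r • w)) (sphere 0 1) :=
    hdG.clm_apply continuousOn_const
  have hpGt (k : Fin n) : ContinuousOn (fun w => partialDeriv k Gt (x₀ + r • w)) (sphere 0 1) :=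
    hdGt.clm_apply continuousOn_const
  have hcoord : ContinuousOn (fun w : Euc n => w j) (sphere 0 1) := by fun_prop
  simp only [setIntegral_sphere_eq hn x₀ hr.1, hν, hνj, inner_gradient_eq_sum, sphereFlux,
    sum_stress_mul]
  have h1 : Integrable (fun w => fderiv ℝ Gt (x₀ + r • w) w * partialDeriv j G (x₀ + r • w)
      + fderiv ℝ G (x₀ + r • w) w * partialDeriv j Gt (x₀ + r • w)) (unitSphereMeasure n) :=
    integrable_unitSphereMeasure
      (((hdGt.clm_apply continuousOn_id).mul (hpG j)).add
        ((hdG.clm_apply continuousOn_id).mul (hpGt j)))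
  have h2 : Integrable (fun w => (∑ k, partialDeriv k G (x₀ + r • w)
      * partialDeriv k Gt (x₀ + r • w)) * w j) (unitSphereMeasure n) :=
    integrable_unitSphereMeasure
      ((continuousOn_finsetSum _ fun k _ => (hpG k).mul (hpGt k)).mul hcoord)
  have h3 : Integrable (fun w => (1 / (p + 1)) * (G (x₀ + r • w) ^ (p + 1) * w j))
      (unitSphereMeasure n) :=
    integrable_unitSphereMeasure (continuousOn_const.mul (hpow.mul hcoord))
  rw [integral_add (f := fun w => _ - _) (h1.sub h2) h3, integral_sub h1 h2, integral_const_mul]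
  unfold partialDeriv
  ring

theorem abs_sphereFlux_sub_le {n : ℕ} {x₀ : Euc n} {V : Fin n → Euc n → ℝ} {s a L ε : ℝ}
    (j : Fin n)
    (hV : ∀ i, ContinuousOn (fun w => V i (x₀ + s • w)) (sphere 0 1))
    (h : ∀ w ∈ sphere (0 : Euc n) 1,
      |s ^ (n - 1) * (∑ i, V i (x₀ + s • w) * w i - a * w j) - L| ≤ ε) :
    |sphereFlux V x₀ s - L * omegaSph n| ≤ ε * omegaSph n := by
  have homega : (unitSphereMeasure n).real Set.univ = omegaSph n := by
    simp [unitSphereMeasure, omegaSph, Measure.real]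
  have hj : Integrable (fun w : Euc n => w j) (unitSphereMeasure n) :=
    integrable_unitSphereMeasure (by fun_prop)
  have hsum : Integrable (fun w => ∑ i, V i (x₀ + s • w) * w i) (unitSphereMeasure n) :=
    integrable_unitSphereMeasure
      (continuousOn_finsetSum _ fun i _ => (hV i).mul (by fun_prop))
  have heq : ∫ w, (s ^ (n - 1) * (∑ i, V i (x₀ + s • w) * w i - a * w j) - L)
      ∂unitSphereMeasure n = sphereFlux V x₀ s - L * omegaSph n := by
    rw [integral_sub (f := fun w => s ^ (n - 1) * (∑ i, V i (x₀ + s • w) * w i - a * w j))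
        ((hsum.sub (hj.const_mul a)).const_mul _) (integrable_const L),
      integral_const_mul, integral_sub hsum (hj.const_mul a), integral_const_mul,
      integral_coord_unitSphereMeasure, integral_const, homega, sphereFlux, smul_eq_mul]
    ring
  rw [← heq, ← homega, ← Real.norm_eq_abs]
  refine norm_integral_le_of_norm_le_const ?_
  filter_upwards [ae_unitSphereMeasure_mem n] with w hw using h w hw

/-- Pohozaev-type boundary integral involving `G` and the iterated kernel `G̃`
is independent of the radius and equals `(n-2) c_n ω_{n-1} ∂_j H̃(x₀)`. -/
theorem sphere_integral_of_iterated_green_function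
    (n : ℕ) (hn : 5 ≤ n)
    (p : ℝ) (hp1 : 1 ≤ p) (hp2 : p < ((n : ℝ) - 1) / ((n : ℝ) - 2))
    (x₀ : Euc n) (R : ℝ) (hR : 0 < R)
    (H : Euc n → ℝ)
    (hH2 : ContDiffOn ℝ 2 H (ball x₀ R))
    (hHharm : ∀ x ∈ ball x₀ R, lap n H x = 0)
    (Ht : Euc n → ℝ) (hHt : ContDiffOn ℝ 1 Ht (ball x₀ R))
    (G Gt : Euc n → ℝ)
    (hG : ∀ x, x ≠ x₀ → G x = cGreen n * ‖x - x₀‖ ^ ((2 : ℝ) - n) - H x)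
    (hGt : ∀ x, x ≠ x₀ →
      Gt x = alpha1 n p * ‖x - x₀‖ ^ (-(((n : ℝ) - 2) * p - 2)) - Ht x)
    (hGpos : ∀ x ∈ ball x₀ R, x ≠ x₀ → 0 < G x)
    (hGt2 : ContDiffOn ℝ 2 Gt (ball x₀ R \ {x₀}))
    (heq : ∀ x ∈ ball x₀ R, x ≠ x₀ → -lap n Gt x = (G x) ^ p)
    (r : ℝ) (hr : 0 < r) (hrR : r < R) (j : Fin n) :
    (∫ x in sphere x₀ r,
        (fderiv ℝ Gt x (r⁻¹ • (x - x₀)) * fderiv ℝ G x (EuclideanSpace.single j 1)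
          + fderiv ℝ G x (r⁻¹ • (x - x₀)) * fderiv ℝ Gt x (EuclideanSpace.single j 1))
        ∂(surf n))
      - (∫ x in sphere x₀ r, ⟪gradient G x, gradient Gt x⟫ * ((x j - x₀ j) / r) ∂(surf n))
      + (1 / (p + 1)) *
          ∫ x in sphere x₀ r, (G x) ^ (p + 1) * ((x j - x₀ j) / r) ∂(surf n)
    = ((n : ℝ) - 2) * cGreen n * omegaSph n
        * fderiv ℝ Ht x₀ (EuclideanSpace.single j 1) := by
  have hn5 : (5 : ℝ) ≤ n := by exact_mod_cast hn
  have hp : 0 < p := by linarith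
  have hp2' : ((n : ℝ) - 2) * p < n - 1 := by
    rwa [lt_div_iff₀ (by linarith), mul_comm] at hp2
  have hω : 0 ≤ omegaSph n := ENNReal.toReal_nonneg
  have hc : 0 ≤ cGreen n := div_nonneg zero_le_one (mul_nonneg (by linarith) hω)
  have hev {x : Euc n} (hx : x ∈ ball x₀ R \ {x₀}) :
      G =ᶠ[𝓝 x] fun y => cGreen n * ‖y - x₀‖ ^ ((2 : ℝ) - n) - H y := by
    filter_upwards [isOpen_ne.mem_nhds hx.2] with y hy using hG y hy
  have hHat {x : Euc n} (hx : x ∈ ball x₀ R \ {x₀}) : ContDiffAt ℝ 2 H x :=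
    hH2.contDiffAt (isOpen_ball.mem_nhds hx.1)
  have hG2 (x : Euc n) (hx : x ∈ ball x₀ R \ {x₀}) : ContDiffAt ℝ 2 G x :=
    ((contDiffAt_const.mul (contDiffAt_norm_sub_rpow hx.2 _)).sub (hHat hx)).congr_of_eventuallyEq
      (hev hx)
  have hGt2' (x : Euc n) (hx : x ∈ ball x₀ R \ {x₀}) : ContDiffAt ℝ 2 Gt x :=
    hGt2.contDiffAt ((isOpen_ball.sdiff isClosed_singleton).mem_nhds hx)
  have hlap (x : Euc n) (hx : x ∈ ball x₀ R \ {x₀}) : lap n G x = 0 := by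
    rw [lap_congr (hev hx), lap_const_mul_sub (contDiffAt_norm_sub_rpow hx.2 _) (hHat hx),
      lap_norm_sub_rpow hx.2, hHharm x hx.1]
    ring
  have hV (i : Fin n) (x : Euc n) (hx : x ∈ ball x₀ R \ {x₀}) :
      ContDiffAt ℝ 1 (stress p G Gt j i) x :=
    contDiffAt_stress (hG2 x hx) (hGt2' x hx) (hGpos x hx.1 hx.2) j i
  have hdiv (x : Euc n) (hx : x ∈ ball x₀ R \ {x₀}) :
      ∑ i, fderiv ℝ (stress p G Gt j i) x (EuclideanSpace.single i 1) = 0 :=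
    div_stress_eq_zero hp (hG2 x hx) (hGt2' x hx) (hGpos x hx.1 hx.2) (hlap x hx)
      (heq x hx.1 hx.2) j
  rw [sphere_integrals_eq_sphereFlux (by omega) ⟨hr, hrR⟩
    (fun x hx => (hG2 x hx).of_le (by norm_num)) (fun x hx => (hGt2' x hx).of_le (by norm_num))
    (fun x hx => hGpos x hx.1 hx.2) j]
  have hbound (ε : ℝ) (hε : 0 < ε) : |sphereFlux (stress p G Gt j) x₀ r
      - ((n : ℝ) - 2) * cGreen n * partialDeriv j Ht x₀ * omegaSph n| ≤ ε * omegaSph n := by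
    obtain ⟨A, hA⟩ := eventually_flux_density_sub_le (by omega) hp hp2' hc hR
      (hH2.of_le (by norm_num)) hHt hG hGt hGpos j hε
    obtain ⟨s, hAs, hs⟩ := (hA.and (Ioo_mem_nhdsGT hR)).exists
    rw [sphereFlux_eq (by omega) hV hdiv ⟨hr, hrR⟩ hs]
    exact abs_sphereFlux_sub_le j (fun i w hw =>
      (ContinuousAt.comp (f := fun w => x₀ + s • w)
        (hV i _ (mem_punctured_ball hs hw)).continuousAt (by fun_prop)).continuousWithinAt) hAs
  have hzero : |sphereFlux (stress p G Gt j) x₀ r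
      - ((n : ℝ) - 2) * cGreen n * partialDeriv j Ht x₀ * omegaSph n| ≤ 0 := by
    refine le_of_forall_pos_le_add fun ε hε => ?_
    refine (hbound (ε / (omegaSph n + 1)) (by positivity)).trans ?_
    rw [zero_add, div_mul_eq_mul_div, div_le_iff₀ (by positivity)]
    nlinarith
  rw [sub_eq_zero.1 (abs_nonpos_iff.1 hzero), partialDeriv]
  ring
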